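/- (A priori bound on the surface pair density, key step in the reconstruction of the condensate.) Let β > 0, λ > 0, α ≥ 0 and μ̄ ∈ ℝ. Then there exists a constant C > 0 such that for every natural number N ≥ 1, all real numbers λ_1,…,λ_N ≥ 0, every μ ≤ μ̄, and every ρ_s ≥ 0 satisfying λρ_s − α − μ > 0 and the self-consistency equation ρ_s = (1/N) Σ_{j=1}^N 1/(exp(β(λ_j + λρ_s − α − μ)) − 1), one has ρ_s ≤ C. -/

import Mathlib

open Real

/-- A priori bound on the surface pair density, key step in the
reconstruction of the condensate: Let `β > 0`, `λ > 0`, `α ≥ 0` and `μ̄ ∈ ℝ`.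
Then there exists `C > 0` such that for every `N ≥ 1`, all `λ_1,…,λ_N ≥ 0`,
every `μ ≤ μ̄`, and every `ρ_s ≥ 0` satisfying `λρ_s - α - μ > 0` and the
self-consistency equation
`ρ_s = (1/N) ∑_{j=1}^N 1/(exp(β(λ_j + λρ_s - α - μ)) - 1)`,
one has `ρ_s ≤ C`. -/
theorem surface_density_uniform_bound
    (β lam α μbar : ℝ) (hβ : 0 < β) (hlam : 0 < lam) (hα : 0 ≤ α) :
    ∃ C : ℝ, 0 < C ∧
      ∀ (N : ℕ), 1 ≤ N →
        ∀ ev : Fin N → ℝ, (∀ j, 0 ≤ ev j) →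
          ∀ μ : ℝ, μ ≤ μbar →
            ∀ ρs : ℝ, 0 ≤ ρs →
              0 < lam * ρs - α - μ →
              ρs = (1 / (N : ℝ)) *
                  ∑ j : Fin N, 1 / (Real.exp (β * (ev j + lam * ρs - α - μ)) - 1) →
              ρs ≤ C := by
  have hM : α + μbar ≤ |α + μbar| := le_abs_self _
  have hM0 : 0 ≤ |α + μbar| := abs_nonneg _
  have hb : 0 < 1 / β := by positivity
  have hl : 0 < (|α + μbar| + 1) / lam := by positivity
  refine ⟨(|α + μbar| + 1) / lam + 1 / β, by positivity, ?_⟩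
  intro N hN ev hev μ hμ ρs _ _ heq
  by_contra! hlt
  have h1 : |α + μbar| + 1 < lam * ρs := by
    have : (|α + μbar| + 1) / lam < ρs := by linarith
    rw [div_lt_iff₀ hlam] at this
    linarith
  have hterm : ∀ j ∈ (Finset.univ : Finset (Fin N)),
      1 / (Real.exp (β * (ev j + lam * ρs - α - μ)) - 1) ≤ 1 / β := by
    intro j _
    apply one_div_le_one_div_of_le hβ
    have h2 : 1 ≤ ev j + lam * ρs - α - μ := by linarith [hev j]
    have h3 := Real.add_one_le_exp (β * (ev j + lam * ρs - α - μ))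
    nlinarith
  have hsum := Finset.sum_le_card_nsmul _ _ _ hterm
  have hNpos : (0 : ℝ) < N := by exact_mod_cast hN
  simp only [Finset.card_univ, Fintype.card_fin, nsmul_eq_mul] at hsum
  have h4 : ρs ≤ 1 / β := by
    calc ρs = _ := heq
      _ ≤ (1 / (N : ℝ)) * (N * (1 / β)) := by
          exact mul_le_mul_of_nonneg_left hsum (by positivity)
      _ = 1 / β := by field_simp
  linarith
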